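/- arXiv:1407.5651 — 3 statements merged into one kernel-verified Lean document; each statement's English description precedes it below -/
import Mathlib

section
/- For every choice of positive rate constants k1,…,k30 and every x ∈ ℝ^22, the mass action vector field of Net1 vanishes at x (f(x) = 0) if and only if the following 15 binomials all vanish at x: (k2+k3)x13 − k1·x1·x9, (k5+k6)x18 − k4·x2·x10, k3·x13 − k6·x18, (k8+k9)x14 − k7·x2·x3, (k17+k18)x20 − k16·x4·x11, k9·x14 − k18·x20, (k11+k12)x15 − k10·x2·x4, (k14+k15)x19 − k13·x5·x11, k12·x15 − k15·x19, (k20+k21)x16 − k19·x5·x6, (k29+k30)x22 − k28·x7·x12, k21·x16 − k30·x22, (k23+k24)x17 − k22·x5·x7, (k26+k27)x21 − k25·x8·x12, k24·x17 − k27·x21. -/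
/-- The `j`-th standard basis vector of `ℕ^22`. -/
def ee (j : Fin 22) : Fin 22 → ℕ := fun i => if i = j then 1 else 0

/-- The 10 motifs `A + B ⇄ C → D + B` of Net1, recorded as tuples `(A, B, C, D)`
(0-based species indices, so `Xⱼ` is index `j - 1`). -/
def motifs1 : Fin 10 → Fin 22 × Fin 22 × Fin 22 × Fin 22 :=
  ![(0, 8, 12, 1),
    (1, 9, 17, 0),
    (2, 1, 13, 3),
    (3, 1, 14, 4),
    (4, 10, 18, 3),
    (3, 10, 19, 2),
    (5, 4, 15, 6),
    (6, 4, 16, 7),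
    (7, 11, 20, 6),
    (6, 11, 21, 5)]

/-- Exponent vector of the source complex of the `i`-th reaction of Net1
(motif `i / 3`; reactions `A+B → C`, `C → A+B`, `C → D+B`). -/
def src1 (i : Fin 30) : Fin 22 → ℕ :=
  let m := motifs1 ⟨i.val / 3, by have := i.isLt; omega⟩
  if i.val % 3 = 0 then ee m.1 + ee m.2.1 else ee m.2.2.1

/-- Exponent vector of the product complex of the `i`-th reaction of Net1. -/
def tgt1 (i : Fin 30) : Fin 22 → ℕ :=
  let m := motifs1 ⟨i.val / 3, by have := i.isLt; omega⟩
  if i.val % 3 = 0 then ee m.2.2.1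
  else if i.val % 3 = 1 then ee m.1 + ee m.2.1
  else ee m.2.2.2 + ee m.2.1

/-- The mass action vector field of Net1: `f(x)ⱼ = Σᵢ kᵢ x^{yᵢ} ((yᵢ')ⱼ − (yᵢ)ⱼ)`. -/
def massAction1 (k : Fin 30 → ℝ) (x : Fin 22 → ℝ) : Fin 22 → ℝ :=
  fun j => ∑ i : Fin 30,
    k i * (∏ l : Fin 22, x l ^ src1 i l) * ((tgt1 i j : ℝ) - (src1 i j : ℝ))

theorem prod_ee (x : Fin 22 → ℝ) (a : Fin 22) : ∏ l : Fin 22, x l ^ ee a l = x a := by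
  simp [ee, Finset.prod_ite_eq, pow_ite]

theorem prod_ee2 (x : Fin 22 → ℝ) (a b : Fin 22) :
    ∏ l : Fin 22, x l ^ (ee a + ee b) l = x a * x b := by
  simp only [Pi.add_apply, pow_add, Finset.prod_mul_distrib, prod_ee]

/-- Contribution of one motif. -/
noncomputable def mot (x : Fin 22 → ℝ) (j : Fin 22) (p q r : ℝ) (a b c d : Fin 22) : ℝ :=
  p * (x a * x b) * ((ee c j : ℝ) - ((ee a + ee b) j : ℕ))
  + q * x c * (((ee a + ee b) j : ℕ) - (ee c j : ℝ))
  + r * x c * (((ee d + ee b) j : ℕ) - (ee c j : ℝ))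

theorem sum_thirty (g : Fin 30 → ℝ) : ∑ i, g i = ∑ m : Fin 10,
    (g ⟨3 * m.val, by omega⟩ + g ⟨3 * m.val + 1, by omega⟩ + g ⟨3 * m.val + 2, by omega⟩) := by
  simp only [Fin.sum_univ_succ, Fin.sum_univ_zero]
  simp [Fin.succ]
  ring

theorem massAction1_eq (k : Fin 30 → ℝ) (x : Fin 22 → ℝ) (j : Fin 22) :
    massAction1 k x j = ∑ m : Fin 10,
      mot x j (k ⟨3 * m.val, by omega⟩) (k ⟨3 * m.val + 1, by omega⟩) (k ⟨3 * m.val + 2, by omega⟩)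
        (motifs1 m).1 (motifs1 m).2.1 (motifs1 m).2.2.1 (motifs1 m).2.2.2 := by
  unfold massAction1
  rw [sum_thirty]
  refine Finset.sum_congr rfl fun m _ => ?_
  have h0 : 3 * m.val / 3 = m.val := by omega
  have h1 : (3 * m.val + 1) / 3 = m.val := by omega
  have h2 : (3 * m.val + 2) / 3 = m.val := by omega
  have e0 : 3 * m.val % 3 = 0 := by omega
  have e1 : (3 * m.val + 1) % 3 = 1 := by omega
  have e2 : (3 * m.val + 2) % 3 = 2 := by omega
  simp only [src1, tgt1, h0, h1, h2, e0, e1, e2, if_true, if_false, one_ne_zero,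
    OfNat.ofNat_ne_zero, OfNat.ofNat_ne_one, prod_ee, prod_ee2, mot, Fin.eta]

/-- For every choice of positive rate constants and every `x ∈ ℝ^22`, the mass action
vector field of Net1 vanishes at `x` iff the 15 binomials vanish at `x`.
(Rate constant `kⱼ` of the paper is `k (j-1)` here, species `Xⱼ` is `x (j-1)`.) -/
theorem net1_steady_state_iff_binomials (k : Fin 30 → ℝ) (hk : ∀ i, 0 < k i)
    (x : Fin 22 → ℝ) :
    massAction1 k x = 0 ↔
      (((k 1 + k 2) * x 12 - k 0 * (x 0 * x 8) = 0) ∧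
      ((k 4 + k 5) * x 17 - k 3 * (x 1 * x 9) = 0) ∧
      (k 2 * x 12 - k 5 * x 17 = 0) ∧
      ((k 7 + k 8) * x 13 - k 6 * (x 1 * x 2) = 0) ∧
      ((k 16 + k 17) * x 19 - k 15 * (x 3 * x 10) = 0) ∧
      (k 8 * x 13 - k 17 * x 19 = 0) ∧
      ((k 10 + k 11) * x 14 - k 9 * (x 1 * x 3) = 0) ∧
      ((k 13 + k 14) * x 18 - k 12 * (x 4 * x 10) = 0) ∧
      (k 11 * x 14 - k 14 * x 18 = 0) ∧
      ((k 19 + k 20) * x 15 - k 18 * (x 4 * x 5) = 0) ∧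
      ((k 28 + k 29) * x 21 - k 27 * (x 6 * x 11) = 0) ∧
      (k 20 * x 15 - k 29 * x 21 = 0) ∧
      ((k 22 + k 23) * x 16 - k 21 * (x 4 * x 6) = 0) ∧
      ((k 25 + k 26) * x 20 - k 24 * (x 7 * x 11) = 0) ∧
      (k 23 * x 16 - k 26 * x 20 = 0)) := by
  have E : ∀ j, massAction1 k x j = _ := massAction1_eq k x
  simp only [Fin.sum_univ_succ, Fin.sum_univ_zero] at E
  simp [motifs1, mot, Fin.succ] at E
  constructor
  · intro h
    have H : ∀ j, massAction1 k x j = 0 := fun j => by rw [h]; rfl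
    simp only [E] at H
    clear E h
    have h0 := H 0
    simp [ee] at h0
    have h2 := H 2
    simp [ee] at h2
    have h4 := H 4
    simp [ee] at h4
    have h5 := H 5
    simp [ee] at h5
    have h7 := H 7
    simp [ee] at h7
    have h12 := H 12
    simp [ee] at h12
    have h13 := H 13
    simp [ee] at h13
    have h14 := H 14
    simp [ee] at h14
    have h15 := H 15
    simp [ee] at h15
    have h16 := H 16
    simp [ee] at h16
    have h17 := H 17
    simp [ee] at h17
    have h18 := H 18
    simp [ee] at h18
    have h19 := H 19
    simp [ee] at h19
    have h20 := H 20
    simp [ee] at h20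
    have h21 := H 21
    simp [ee] at h21
    clear H
    refine ⟨?_, ?_, ?_, ?_, ?_, ?_, ?_, ?_, ?_, ?_, ?_, ?_, ?_, ?_, ?_⟩ <;> linarith
  · rintro ⟨a1, a2, a3, a4, a5, a6, a7, a8, a9, a10, a11, a12, a13, a14, a15⟩
    funext j
    rw [E j]
    clear E
    fin_cases j <;> simp [ee] <;> linarith
end

section
/- The ℝ-linear span in ℝ^22 of the 30 reaction vectors y_i' − y_i of Net1 (which coincide with the reaction vectors of its translation Tran1) has dimension exactly 15; since the translated network Tran1 has 20 complexes and 5 linkage classes, its deficiency equals 20 − 5 − 15 = 0. -/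
/-- The reaction vector `yᵢ' − yᵢ ∈ ℝ^22` of the `i`-th reaction of Net1
(these coincide with the reaction vectors of the translation Tran1). -/
def reactionVec1 (i : Fin 30) : Fin 22 → ℝ :=
  fun j => (tgt1 i j : ℝ) - (src1 i j : ℝ)

/-- Integer reaction vectors. -/
def rz (i : Fin 30) (j : Fin 22) : ℤ := (tgt1 i j : ℤ) - (src1 i j : ℤ)

/-- Indices of the basis reactions. -/
def bidx : Fin 15 → Fin 30 := ![0, 3, 6, 9, 12, 15, 18, 21, 24, 27, 2, 8, 11, 20, 23]

/-- Coordinate functionals dual to the basis reactions. -/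
def dualL : Fin 15 → Fin 22 → ℤ :=
  ![![-1, 0, 0, 0, 0, 0, 0, 0, 0, 0, 0, 0, 0, 0, 0, 0, 0, 0, 0, 0, 0, 0],
    ![0, 0, 0, 0, 0, 0, 0, 0, 0, 0, 0, 0, 0, 0, 0, 0, 0, 1, 0, 0, 0, 0],
    ![0, 0, -1, 0, 0, 0, 0, 0, 0, 0, 0, 0, 0, 0, 0, 0, 0, 0, 0, 0, 0, 0],
    ![0, 0, 0, 0, 1, 0, 0, 0, 0, 0, 0, 0, 0, 0, 1, 1, 1, 0, 1, 0, 0, 0],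
    ![0, 0, 0, 0, 0, 0, 0, 0, 0, 0, 0, 0, 0, 0, 0, 0, 0, 0, 1, 0, 0, 0],
    ![0, 0, 0, 0, 0, 0, 0, 0, 0, 0, 0, 0, 0, 0, 0, 0, 0, 0, 0, 1, 0, 0],
    ![0, 0, 0, 0, 0, -1, 0, 0, 0, 0, 0, 0, 0, 0, 0, 0, 0, 0, 0, 0, 0, 0],
    ![0, 0, 0, 0, 0, 0, 0, 1, 0, 0, 0, 0, 0, 0, 0, 0, 1, 0, 0, 0, 1, 0],
    ![0, 0, 0, 0, 0, 0, 0, 0, 0, 0, 0, 0, 0, 0, 0, 0, 0, 0, 0, 0, 1, 0],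
    ![0, 0, 0, 0, 0, 0, 0, 0, 0, 0, 0, 0, 0, 0, 0, 0, 0, 0, 0, 0, 0, 1],
    ![-1, 0, 0, 0, 0, 0, 0, 0, 0, 0, 0, 0, -1, 0, 0, 0, 0, 0, 0, 0, 0, 0],
    ![0, 0, -1, 0, 0, 0, 0, 0, 0, 0, 0, 0, 0, -1, 0, 0, 0, 0, 0, 0, 0, 0],
    ![0, 0, 0, 0, 1, 0, 0, 0, 0, 0, 0, 0, 0, 0, 0, 1, 1, 0, 1, 0, 0, 0],
    ![0, 0, 0, 0, 0, -1, 0, 0, 0, 0, 0, 0, 0, 0, 0, -1, 0, 0, 0, 0, 0, 0],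
    ![0, 0, 0, 0, 0, 0, 0, 1, 0, 0, 0, 0, 0, 0, 0, 0, 0, 0, 0, 0, 1, 0]]

theorem dual_eq : ∀ i j : Fin 15,
    ∑ k, dualL i k * rz (bidx j) k = if i = j then 1 else 0 := by
  decide +kernel

theorem expand_eq : ∀ (i : Fin 30) (k : Fin 22),
    rz i k = ∑ j : Fin 15, (∑ l, dualL j l * rz i l) * rz (bidx j) k := by
  decide +kernel

theorem rv_eq (i : Fin 30) (k : Fin 22) : reactionVec1 i k = (rz i k : ℝ) := by
  simp [reactionVec1, rz]

theorem basis_indep : LinearIndependent ℝ (fun j => reactionVec1 (bidx j)) := by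
  rw [Fintype.linearIndependent_iff]
  intro g hg i
  have h1 : ∑ k, (dualL i k : ℝ) * (∑ j, g j • reactionVec1 (bidx j)) k = 0 := by
    rw [hg]; simp
  have h2 : ∀ j, ∑ k, (dualL i k : ℝ) * (rz (bidx j) k : ℝ) = if i = j then 1 else 0 := by
    intro j
    exact_mod_cast dual_eq i j
  simp only [Finset.sum_apply, Pi.smul_apply, smul_eq_mul, rv_eq, Finset.mul_sum] at h1
  rw [Finset.sum_comm] at h1
  have h3 : ∀ j, ∑ k, (dualL i k : ℝ) * (g j * (rz (bidx j) k : ℝ))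
      = g j * if i = j then 1 else 0 := by
    intro j
    rw [← h2 j, Finset.mul_sum]
    exact Finset.sum_congr rfl fun k _ => by ring
  simpa [h3] using h1

theorem span_eq : Submodule.span ℝ (Set.range reactionVec1)
    = Submodule.span ℝ (Set.range fun j => reactionVec1 (bidx j)) := by
  apply le_antisymm
  · rw [Submodule.span_le]
    rintro _ ⟨i, rfl⟩
    have h : reactionVec1 i
        = ∑ j, ((∑ l, dualL j l * rz i l : ℤ) : ℝ) • reactionVec1 (bidx j) := by
      funext k
      simp only [Finset.sum_apply, Pi.smul_apply, smul_eq_mul, rv_eq]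
      exact_mod_cast expand_eq i k
    rw [h]
    exact Submodule.sum_mem _ fun j _ =>
      Submodule.smul_mem _ _ (Submodule.subset_span ⟨j, rfl⟩)
  · apply Submodule.span_mono
    rintro _ ⟨j, rfl⟩
    exact ⟨bidx j, rfl⟩

/-- The ℝ-linear span of the 30 reaction vectors of Net1 (equivalently, of its
translation Tran1) has dimension exactly 15; since Tran1 has 20 complexes and 5
linkage classes, its deficiency is `20 - 5 - 15 = 0`. -/
theorem net1_stoichiometric_dimension_and_deficiency :
    Module.finrank ℝ (Submodule.span ℝ (Set.range reactionVec1)) = 15 ∧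
    20 - 5 - Module.finrank ℝ (Submodule.span ℝ (Set.range reactionVec1)) = 0 := by
  have h : Module.finrank ℝ (Submodule.span ℝ (Set.range reactionVec1)) = 15 := by
    rw [span_eq, finrank_span_eq_card basis_indep]
    simp
  exact ⟨h, by rw [h]⟩
end

section
/- Let v1,…,v20 ∈ ℕ^22 ⊂ ℝ^22 be the kinetic complexes of the translation Tran1 of Net1, grouped into five quadruples (per linkage class): (e1+e9, e13, e2+e10, e18), (e2+e3, e14, e4+e11, e20), (e2+e4, e15, e5+e11, e19), (e5+e6, e16, e7+e12, e22), (e5+e7, e17, e8+e12, e21), where e_j is the j-th standard basis vector. Within each quadruple (w1,w2,w3,w4) the edges of the translated reaction graph are w1→w2, w2→w1, w2→w3, w3→w4, w4→w3, w4→w1. Then the ℝ-linear span of all edge differences (target minus source, over all 30 edges) has dimension exactly 15; hence the kinetic-order deficiency of Tran1 is 20 − 5 − 15 = 0. -/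
/-- The `j`-th standard basis vector of `ℝ^22`. -/
def eR (j : Fin 22) : Fin 22 → ℝ := fun i => if i = j then 1 else 0

/-- The 20 kinetic complexes of the translation Tran1 of Net1 (as vectors in
`ℕ^22 ⊂ ℝ^22`), grouped into 5 quadruples, one per linkage class. `eR j` is the
standard basis vector of 0-based index `j`, i.e. the species `X(j+1)`. -/
def kinComplex1 : Fin 20 → Fin 22 → ℝ :=
  ![eR 0 + eR 8,
    eR 12,
    eR 1 + eR 9,
    eR 17,
    eR 1 + eR 2,
    eR 13,
    eR 3 + eR 10,
    eR 19,
    eR 1 + eR 3,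
    eR 14,
    eR 4 + eR 10,
    eR 18,
    eR 4 + eR 5,
    eR 15,
    eR 6 + eR 11,
    eR 21,
    eR 4 + eR 6,
    eR 16,
    eR 7 + eR 11,
    eR 20]

/-- The directed edges of the translated reaction graph of Tran1: within each quadruple
`(w₁, w₂, w₃, w₄)` the edges are `w₁→w₂, w₂→w₁, w₂→w₃, w₃→w₄, w₄→w₃, w₄→w₁`
(pairs are `(source, target)`). -/
def kinEdges1 : Fin 30 → Fin 20 × Fin 20 :=
  ![(0, 1), (1, 0), (1, 2), (2, 3), (3, 2), (3, 0), (4, 5), (5, 4), (5, 6), (6, 7), (7, 6), (7, 4), (8, 9), (9, 8), (9, 10), (10, 11), (11, 10), (11, 8), (12, 13), (13, 12), (13, 14), (14, 15), (15, 14), (15, 12), (16, 17), (17, 16), (17, 18), (18, 19), (19, 18), (19, 16)]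

/-- Difference of kinetic complexes along an edge: target minus source. -/
def kinEdgeDiff1 (i : Fin 30) : Fin 22 → ℝ :=
  kinComplex1 (kinEdges1 i).2 - kinComplex1 (kinEdges1 i).1

/-- Edges giving a basis. -/
def basisEdges1 : Fin 15 → Fin 30 :=
  ![0, 2, 3, 6, 8, 9, 12, 14, 15, 18, 20, 21, 24, 26, 27]

set_option maxHeartbeats 4000000 in
theorem basis_li1 : LinearIndependent ℝ (fun i => kinEdgeDiff1 (basisEdges1 i)) := by
  rw [Fintype.linearIndependent_iff]
  intro g hg
  have h := fun j => congrFun hg j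
  simp only [Fin.sum_univ_succ, Fin.sum_univ_zero, Pi.add_apply, Pi.smul_apply, Pi.zero_apply,
    smul_eq_mul] at h
  have h0 := h 0
  have h2 := h 2
  have h4 := h 4
  have h5 := h 5
  have h7 := h 7
  have h10 := h 10
  have h12 := h 12
  have h13 := h 13
  have h14 := h 14
  have h15 := h 15
  have h16 := h 16
  have h17 := h 17
  have h18 := h 18
  have h19 := h 19
  have h20 := h 20
  have h21 := h 21
  clear h hg
  simp [basisEdges1, kinEdgeDiff1, kinEdges1, kinComplex1, eR] at h0 h2 h4 h5 h7 h10 h12 h13 h14 h15 h16 h17 h18 h19 h20 h21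
  intro i
  fin_cases i <;> simp <;> linarith

theorem span_eq1 : Submodule.span ℝ (Set.range kinEdgeDiff1) =
    Submodule.span ℝ (Set.range (fun i => kinEdgeDiff1 (basisEdges1 i))) := by
  apply le_antisymm
  · rw [Submodule.span_le]
    rintro _ ⟨i, rfl⟩
    have hb : ∀ k : Fin 15, kinEdgeDiff1 (basisEdges1 k) ∈
        Submodule.span ℝ (Set.range (fun i => kinEdgeDiff1 (basisEdges1 i))) :=
      fun k => Submodule.subset_span ⟨k, rfl⟩
    have key : (∃ k, i = basisEdges1 k) ∨
        (∃ k, (kinEdges1 i).1 = (kinEdges1 (basisEdges1 k)).2 ∧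
          (kinEdges1 i).2 = (kinEdges1 (basisEdges1 k)).1) ∨
        (∃ k l m, (kinEdges1 i).1 = (kinEdges1 (basisEdges1 m)).2 ∧
          (kinEdges1 (basisEdges1 m)).1 = (kinEdges1 (basisEdges1 l)).2 ∧
          (kinEdges1 (basisEdges1 l)).1 = (kinEdges1 (basisEdges1 k)).2 ∧
          (kinEdges1 i).2 = (kinEdges1 (basisEdges1 k)).1) := by
      have hi : i.val = 6 * (i.val / 6) + i.val % 6 := by omega
      fin_cases i
      all_goals first
        | exact Or.inl (by decide)
        | exact Or.inr (Or.inl (by decide))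
        | skip
      · exact Or.inr (Or.inr ⟨0, 1, 2, by decide⟩)
      · exact Or.inr (Or.inr ⟨3, 4, 5, by decide⟩)
      · exact Or.inr (Or.inr ⟨6, 7, 8, by decide⟩)
      · exact Or.inr (Or.inr ⟨9, 10, 11, by decide⟩)
      · exact Or.inr (Or.inr ⟨12, 13, 14, by decide⟩)
    rcases key with ⟨k, rfl⟩ | ⟨k, h1, h2⟩ | ⟨k, l, m, h1, h2, h3, h4⟩
    · exact hb k
    · have : kinEdgeDiff1 i = - kinEdgeDiff1 (basisEdges1 k) := by
        simp only [kinEdgeDiff1, h1, h2]; abel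
      rw [this]
      exact Submodule.neg_mem _ (hb k)
    · have : kinEdgeDiff1 i = - (kinEdgeDiff1 (basisEdges1 k) + kinEdgeDiff1 (basisEdges1 l)
          + kinEdgeDiff1 (basisEdges1 m)) := by
        simp only [kinEdgeDiff1, h1, h2, h3, h4]; abel
      rw [this]
      exact Submodule.neg_mem _ (Submodule.add_mem _ (Submodule.add_mem _ (hb k) (hb l)) (hb m))
  · apply Submodule.span_mono
    rintro _ ⟨i, rfl⟩
    exact ⟨_, rfl⟩

theorem tran1_kinetic_order_dimension_and_deficiency :
    Module.finrank ℝ (Submodule.span ℝ (Set.range kinEdgeDiff1)) = 15 ∧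
    20 - 5 - Module.finrank ℝ (Submodule.span ℝ (Set.range kinEdgeDiff1)) = 0 := by
  have h : Module.finrank ℝ (Submodule.span ℝ (Set.range kinEdgeDiff1)) = 15 := by
    rw [span_eq1, finrank_span_eq_card basis_li1]
    simp
  exact ⟨h, by rw [h]⟩
end
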